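/- If A is an equational Artinian L-structure, then for every natural number n the collection of finite unions of A-radical ideals in At_L(x₁,…,xₙ) satisfies the descending chain condition: every descending chain M₁ ⊇ M₂ ⊇ ⋯, in which each Mᵢ is a finite union of A-radical ideals, stabilizes. -/

import Mathlib

open FirstOrder

/-- The solution set in `A` of a system `S` of equations in `n` variables. -/
def VSet (L : FirstOrder.Language) (A : Type*) [L.Structure A] {n : ℕ}
    (S : Set (L.Term (Fin n) × L.Term (Fin n))) : Set (Fin n → A) :=
  { a | ∀ pq ∈ S, pq.1.realize a = pq.2.realize a }

/-- A subset of `Aⁿ` is an algebraic set if it is the solution set of some system. -/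
def IsAlgebraicSet (L : FirstOrder.Language) (A : Type*) [L.Structure A] {n : ℕ}
    (Y : Set (Fin n → A)) : Prop :=
  ∃ S, Y = VSet L A S

/-- The radical of a subset `E ⊆ Aⁿ`. -/
def Rad (L : FirstOrder.Language) (A : Type*) [L.Structure A] {n : ℕ}
    (E : Set (Fin n → A)) : Set (L.Term (Fin n) × L.Term (Fin n)) :=
  { pq | ∀ a ∈ E, pq.1.realize a = pq.2.realize a }

/-- An `A`-radical ideal of the term algebra. -/
def IsRadicalIdeal (L : FirstOrder.Language) (A : Type*) [L.Structure A] {n : ℕ}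
    (R : Set (L.Term (Fin n) × L.Term (Fin n))) : Prop :=
  ∃ E : Set (Fin n → A), R = Rad L A E

/-- `A` is equational Artinian: every ascending chain of algebraic sets stabilizes. -/
def EquationalArtinian (L : FirstOrder.Language) (A : Type*) [L.Structure A] : Prop :=
  ∀ (n : ℕ) (Y : ℕ → Set (Fin n → A)),
    (∀ i, IsAlgebraicSet L A (Y i)) → (∀ i, Y i ⊆ Y (i + 1)) →
    ∃ N, ∀ m, N ≤ m → Y m = Y N

/-- The radical topology on atomic formulas: closed sets are arbitrary intersections of
finite unions of `A`-radical ideals. -/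
def radicalTopology (L : FirstOrder.Language) (A : Type*) [L.Structure A] (n : ℕ) :
    TopologicalSpace (L.Term (Fin n) × L.Term (Fin n)) :=
  TopologicalSpace.generateFrom { U | IsRadicalIdeal L A Uᶜ }

/-- The Zariski topology on `Aⁿ`: closed sets are arbitrary intersections of
finite unions of algebraic sets. -/
def zariskiTopology (L : FirstOrder.Language) (A : Type*) [L.Structure A] (n : ℕ) :
    TopologicalSpace (Fin n → A) :=
  TopologicalSpace.generateFrom { U | IsAlgebraicSet L A Uᶜ }

theorem Set.sUnion_descending_chain_stabilizes {α : Type*} (F : Set (Set α))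
    (hwf : WellFoundedLT F) (hinter : ∀ R ∈ F, ∀ R' ∈ F, R ∩ R' ∈ F) (M : ℕ → Set α)
    (hM : ∀ i, ∃ 𝒞 : Set (Set α), 𝒞.Finite ∧ (∀ R ∈ 𝒞, R ∈ F) ∧ M i = ⋃₀ 𝒞)
    (hanti : Antitone M) (R : F) :
    ∃ N, ∀ m, N ≤ m → M m ∩ R = M N ∩ R := by
  induction R using hwf.induction with
  | ind R ih =>
  by_cases h : ∀ i, (R : Set α) ⊆ M i
  · exact ⟨0, fun m _ => by
      rw [Set.inter_eq_right.2 (h m), Set.inter_eq_right.2 (h 0)]⟩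
  push Not at h
  obtain ⟨i, hi⟩ := h
  obtain ⟨𝒞, hfin, hF, hMi⟩ := hM i
  have key : ∀ C ∈ 𝒞, ∃ N, ∀ m, N ≤ m → M m ∩ (C ∩ R) = M N ∩ (C ∩ R) := by
    intro C hC
    refine ih ⟨C ∩ R, hinter C (hF C hC) R R.2⟩ ?_
    refine lt_of_le_of_ne (fun x hx => hx.2) fun heq => hi ?_
    have heq' : C ∩ (R : Set α) = R := congrArg Subtype.val heq
    rw [hMi]
    exact (Set.inter_eq_right.1 heq').trans (Set.subset_sUnion_of_mem hC)
  choose! N hN using key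
  obtain ⟨B, hB⟩ := (hfin.image N).bddAbove
  refine ⟨max B i, fun m hm => Set.Subset.antisymm
    (Set.inter_subset_inter_left _ (hanti hm)) fun x hx => ⟨?_, hx.2⟩⟩
  have hxi : x ∈ M i := hanti (le_max_right B i) hx.1
  rw [hMi] at hxi
  obtain ⟨C, hC, hxC⟩ := hxi
  have hNB : N C ≤ B := hB ⟨C, hC, rfl⟩
  have hxN : x ∈ M (N C) ∩ (C ∩ R) :=
    ⟨hanti (hNB.trans (le_max_left B i)) hx.1, hxC, hx.2⟩
  rw [← hN C hC m (hNB.trans ((le_max_left B i).trans hm))] at hxN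
  exact hxN.1

section Radical

variable {L : FirstOrder.Language} {A : Type*} [L.Structure A] {n : ℕ}

theorem IsRadicalIdeal.rad_vSet {R : Set (L.Term (Fin n) × L.Term (Fin n))}
    (hR : IsRadicalIdeal L A R) : Rad L A (VSet L A R) = R := by
  obtain ⟨E, rfl⟩ := hR
  exact Set.Subset.antisymm (fun pq h a ha => h a fun _ hrs => hrs a ha)
    fun pq h a ha => ha pq h

theorem IsRadicalIdeal.univ :
    IsRadicalIdeal L A (Set.univ : Set (L.Term (Fin n) × L.Term (Fin n))) :=
  ⟨∅, by simp [Rad]⟩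

theorem IsRadicalIdeal.inter {R R' : Set (L.Term (Fin n) × L.Term (Fin n))}
    (hR : IsRadicalIdeal L A R) (hR' : IsRadicalIdeal L A R') :
    IsRadicalIdeal L A (R ∩ R') := by
  obtain ⟨E, rfl⟩ := hR
  obtain ⟨E', rfl⟩ := hR'
  refine ⟨E ∪ E', Set.ext fun pq => ⟨?_, fun h => ⟨fun a ha => h a (.inl ha),
    fun a ha => h a (.inr ha)⟩⟩⟩
  rintro ⟨h, h'⟩ a (ha | ha)
  exacts [h a ha, h' a ha]

theorem EquationalArtinian.wellFoundedLT_radicalIdeal (hA : EquationalArtinian L A) :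
    WellFoundedLT {R : Set (L.Term (Fin n) × L.Term (Fin n)) | IsRadicalIdeal L A R} := by
  rw [← wellFoundedGT_dual_iff, wellFoundedGT_iff_monotone_chain_condition]
  intro f
  obtain ⟨N, hN⟩ := hA n (fun i => VSet L A (f i).ofDual.1)
    (fun i => ⟨_, rfl⟩)
    (fun i a ha pq hpq => ha pq (f.monotone (Nat.le_succ i) hpq))
  refine ⟨N, fun m hm => OrderDual.ofDual.injective (Subtype.ext ?_)⟩
  rw [← (f N).ofDual.2.rad_vSet, ← (f m).ofDual.2.rad_vSet, hN m hm]

end Radical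

/-- if `A` is equational Artinian then the finite unions of `A`-radical
ideals satisfy the descending chain condition. -/
theorem finiteUnions_of_radicals_dcc
    {L : FirstOrder.Language} (A : Type*) [L.Structure A]
    (hL : ∀ k, IsEmpty (L.Relations k))
    (hA : EquationalArtinian L A) (n : ℕ)
    (M : ℕ → Set (L.Term (Fin n) × L.Term (Fin n)))
    (hM : ∀ i, ∃ 𝒞 : Set (Set (L.Term (Fin n) × L.Term (Fin n))),
      𝒞.Finite ∧ (∀ R ∈ 𝒞, IsRadicalIdeal L A R) ∧ M i = ⋃₀ 𝒞)
    (hchain : ∀ i, M (i + 1) ⊆ M i) :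
    ∃ N, ∀ m, N ≤ m → M m = M N := by
  obtain ⟨N, hN⟩ := Set.sUnion_descending_chain_stabilizes
    {R : Set (L.Term (Fin n) × L.Term (Fin n)) | IsRadicalIdeal L A R}
    hA.wellFoundedLT_radicalIdeal (fun _ hR _ hR' => hR.inter hR') M hM
    (antitone_nat_of_succ_le hchain) ⟨Set.univ, IsRadicalIdeal.univ⟩
  exact ⟨N, fun m hm => by simpa using hN m hm⟩
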